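/- There exists a constant C > 0, depending only on the data (u_T, m₀, L, T, σ, r, ε), such that every smooth solution (u,m) of the MFG system satisfies ∫₀^T ∫₀^L m(t,x) G(t,x)² dx dt = ∫₀^T ∫₀^L m(t,x) H(t,x) dx dt ≤ C. -/

import Mathlib

open Set MeasureTheory intervalIntegral Function

noncomputable section

/-- Spatial derivative `u_x`. -/
def pdx (u : ℝ → ℝ → ℝ) (t x : ℝ) : ℝ := deriv (u t) x

/-- Second spatial derivative `u_xx`. -/
def pdxx (u : ℝ → ℝ → ℝ) (t x : ℝ) : ℝ := deriv (deriv (u t)) x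

/-- Time derivative `u_t`. -/
def pdt (u : ℝ → ℝ → ℝ) (t x : ℝ) : ℝ := deriv (fun s => u s x) t

/-- `η(t) = ∫₀^L m(t,x) dx`. -/
def mfgEta (L : ℝ) (m : ℝ → ℝ → ℝ) (t : ℝ) : ℝ := ∫ x in (0:ℝ)..L, m t x

/-- `f(t) = a(η(t)) + c(η(t)) p̄(t)`. -/
def mfgF (L ε : ℝ) (u m : ℝ → ℝ → ℝ) (t : ℝ) : ℝ :=
  2 / (2 + ε * mfgEta L m t)
    + (ε / (2 + ε * mfgEta L m t)) * ∫ x in (0:ℝ)..L, pdx u t x * m t x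

/-- `G(t,x) = (1/2)(f(t) − u_x(t,x))`. -/
def mfgG (L ε : ℝ) (u m : ℝ → ℝ → ℝ) (t x : ℝ) : ℝ :=
  (1/2) * (mfgF L ε u m t - pdx u t x)

/-- `H(t,x) = G(t,x)²`. -/
def mfgH (L ε : ℝ) (u m : ℝ → ℝ → ℝ) (t x : ℝ) : ℝ := (mfgG L ε u m t x)^2

/-- Standing assumptions on the data. -/
structure MFGData (T L σ r ε : ℝ) (uT m0 : ℝ → ℝ) : Prop where
  hT : 0 < T
  hL : 0 < L
  hσ : 0 < σ
  hr : 0 < r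
  hε : 0 ≤ ε
  uT_smooth : ContDiff ℝ 2 uT
  m0_smooth : ContDiff ℝ 2 m0
  uT_zero : uT 0 = 0
  uT_deriv_L : deriv uT L = 0
  uT_nonneg : ∀ x ∈ Icc (0:ℝ) L, 0 ≤ uT x
  uT_deriv_nonneg : ∀ x ∈ Icc (0:ℝ) L, 0 ≤ deriv uT x
  m0_zero : m0 0 = 0
  m0_L : m0 L = 0
  m0_deriv_L : deriv m0 L = 0
  m0_nonneg : ∀ x ∈ Icc (0:ℝ) L, 0 ≤ m0 x
  m0_mass : (∫ x in (0:ℝ)..L, m0 x) = 1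

/-- A smooth solution of the MFG system \eqref{main system}. -/
structure IsMFGSolution (T L σ r ε : ℝ) (uT m0 : ℝ → ℝ) (u m : ℝ → ℝ → ℝ) : Prop where
  u_smooth : ContDiff ℝ (⊤ : ℕ∞) (uncurry u)
  m_smooth : ContDiff ℝ (⊤ : ℕ∞) (uncurry m)
  hjb : ∀ t ∈ Ioo (0:ℝ) T, ∀ x ∈ Ioo (0:ℝ) L,
    pdt u t x + σ^2/2 * pdxx u t x - r * u t x + mfgH L ε u m t x = 0
  fp : ∀ t ∈ Ioo (0:ℝ) T, ∀ x ∈ Ioo (0:ℝ) L,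
    pdt m t x - σ^2/2 * pdxx m t x
      - deriv (fun y => mfgG L ε u m t y * m t y) x = 0
  m_init : ∀ x ∈ Icc (0:ℝ) L, m 0 x = m0 x
  u_term : ∀ x ∈ Icc (0:ℝ) L, u T x = uT x
  u_bdry : ∀ t ∈ Icc (0:ℝ) T, u t 0 = 0
  m_bdry : ∀ t ∈ Icc (0:ℝ) T, m t 0 = 0
  ux_bdry : ∀ t ∈ Icc (0:ℝ) T, pdx u t L = 0
  m_flux : ∀ t ∈ Icc (0:ℝ) T,
    σ^2/2 * pdx m t L + mfgG L ε u m t L * m t L = 0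

end

section PartialDerivatives

variable {u : ℝ → ℝ → ℝ}

lemma contDiff_uncurry_pdx (hu : ContDiff ℝ (⊤ : ℕ∞) (uncurry u)) :
    ContDiff ℝ (⊤ : ℕ∞) (uncurry (pdx u)) := by
  have h : uncurry (pdx u) = fun p : ℝ × ℝ => fderiv ℝ (uncurry u) p (0, 1) := by
    ext ⟨t, x⟩
    have h1 : HasDerivAt (fun y : ℝ => (t, y)) ((0 : ℝ), (1 : ℝ)) x :=
      (hasDerivAt_const x t).prodMk (hasDerivAt_id x)
    have h2 := (hu.differentiable (by simp) (t, x)).hasFDerivAt.comp_hasDerivAt x h1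
    exact h2.deriv
  rw [h]
  exact (hu.fderiv_right (m := (⊤ : ℕ∞)) (by simp)).clm_apply contDiff_const

lemma contDiff_uncurry_pdt (hu : ContDiff ℝ (⊤ : ℕ∞) (uncurry u)) :
    ContDiff ℝ (⊤ : ℕ∞) (uncurry (pdt u)) := by
  have h : uncurry (pdt u) = fun p : ℝ × ℝ => fderiv ℝ (uncurry u) p (1, 0) := by
    ext ⟨t, x⟩
    have h1 : HasDerivAt (fun y : ℝ => (y, x)) ((1 : ℝ), (0 : ℝ)) t :=
      (hasDerivAt_id t).prodMk (hasDerivAt_const t x)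
    have h2 := (hu.differentiable (by simp) (t, x)).hasFDerivAt.comp_hasDerivAt t h1
    exact h2.deriv
  rw [h]
  exact (hu.fderiv_right (m := (⊤ : ℕ∞)) (by simp)).clm_apply contDiff_const

lemma contDiff_uncurry_pdxx (hu : ContDiff ℝ (⊤ : ℕ∞) (uncurry u)) :
    ContDiff ℝ (⊤ : ℕ∞) (uncurry (pdxx u)) :=
  contDiff_uncurry_pdx (contDiff_uncurry_pdx hu)

lemma hasDerivAt_pdx (hu : ContDiff ℝ (⊤ : ℕ∞) (uncurry u)) (t x : ℝ) :
    HasDerivAt (u t) (pdx u t x) x := by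
  have h : Differentiable ℝ fun y => uncurry u (t, y) :=
    (hu.differentiable (by simp)).comp (by fun_prop)
  exact (h x).hasDerivAt

lemma hasDerivAt_pdt (hu : ContDiff ℝ (⊤ : ℕ∞) (uncurry u)) (t x : ℝ) :
    HasDerivAt (fun s => u s x) (pdt u t x) t := by
  have h : Differentiable ℝ fun s => uncurry u (s, x) :=
    (hu.differentiable (by simp)).comp (by fun_prop)
  exact (h t).hasDerivAt

lemma hasDerivAt_pdxx (hu : ContDiff ℝ (⊤ : ℕ∞) (uncurry u)) (t x : ℝ) :
    HasDerivAt (pdx u t) (pdxx u t x) x :=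
  hasDerivAt_pdx (contDiff_uncurry_pdx hu) t x

/-- Differentiation under the integral sign for smooth integrands. -/
lemma hasDerivAt_integral_pdt (hu : ContDiff ℝ (⊤ : ℕ∞) (uncurry u)) (a b t : ℝ) :
    HasDerivAt (fun s => ∫ x in a..b, u s x) (∫ x in a..b, pdt u t x) t := by
  have hc : Continuous (uncurry u) := hu.continuous
  have hc' : Continuous (uncurry (pdt u)) := (contDiff_uncurry_pdt hu).continuous
  obtain ⟨K, hK⟩ := ((isCompact_Icc (a := t - 1) (b := t + 1)).prod
    (isCompact_uIcc (a := a) (b := b))).exists_bound_of_continuousOn hc'.continuousOn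
  refine (intervalIntegral.hasDerivAt_integral_of_dominated_loc_of_deriv_le
    (F' := pdt u) (bound := fun _ => K)
    (Icc_mem_nhds (sub_one_lt t) (lt_add_one t)) ?_ ?_ ?_ ?_ ?_ ?_).2
  · exact Filter.Eventually.of_forall fun s => (hc.uncurry_left s).aestronglyMeasurable
  · exact (hc.uncurry_left t).intervalIntegrable _ _
  · exact (hc'.uncurry_left t).aestronglyMeasurable
  · exact Filter.Eventually.of_forall fun x hx s hs => hK (s, x) ⟨hs, uIoc_subset_uIcc hx⟩
  · exact intervalIntegrable_const
  · exact Filter.Eventually.of_forall fun x _ s _ => hasDerivAt_pdt hu s x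

end PartialDerivatives

section MaximumPrinciple

lemma HasDerivAt.nonpos_of_le_left {f : ℝ → ℝ} {f' a b : ℝ} (hba : b < a)
    (h : HasDerivAt f f' a) (hmin : ∀ y ∈ Ioo b a, f a ≤ f y) : f' ≤ 0 := by
  have h1 := h.tendsto_slope.mono_left
    (nhdsWithin_mono a (fun y (hy : y < a) => hy.ne) : nhdsWithin a (Iio a) ≤ _)
  refine le_of_tendsto h1 ?_
  filter_upwards [Ioo_mem_nhdsLT hba] with y hy
  rw [slope_def_field]
  exact div_nonpos_of_nonneg_of_nonpos (sub_nonneg.2 (hmin y hy)) (sub_nonpos.2 hy.2.le)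

lemma IsLocalMin.deriv_deriv_nonneg {f : ℝ → ℝ} {a : ℝ} (h : IsLocalMin f a)
    (hc : ContinuousAt f a) : 0 ≤ deriv (deriv f) a := by
  by_contra! hneg
  have hmax := isLocalMax_of_deriv_deriv_neg hneg h.deriv_eq_zero hc
  have heq : f =ᶠ[nhds a] fun _ => f a := by
    filter_upwards [h, hmax] with y h1 h2 using le_antisymm h2 h1
  have := heq.deriv.deriv_eq
  simp at this
  exact hneg.ne this

/-- A function on a rectangle that cannot have a negative minimum off the parabolic boundary, by
first and second order conditions, is nonnegative. -/
lemma nonneg_of_no_negative_min {w : ℝ → ℝ → ℝ} {S L : ℝ}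
    (hw : ContDiff ℝ (⊤ : ℕ∞) (uncurry w))
    (hinit : ∀ x ∈ Icc 0 L, 0 ≤ w 0 x) (hleft : ∀ t ∈ Icc 0 S, 0 ≤ w t 0)
    (hright : ∀ t ∈ Ioc 0 S, w t L < 0 → 0 < pdx w t L)
    (hint : ∀ t ∈ Ioc 0 S, ∀ x ∈ Ioo 0 L, w t x < 0 → pdx w t x = 0 → 0 ≤ pdxx w t x →
      0 < pdt w t x) :
    ∀ t ∈ Icc 0 S, ∀ x ∈ Icc 0 L, 0 ≤ w t x := by
  intro t ht x hx
  have hc : Continuous (uncurry w) := hw.continuous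
  obtain ⟨⟨s, y⟩, ⟨hs, hy⟩, hmin⟩ := (isCompact_Icc.prod isCompact_Icc).exists_isMinOn
    ⟨(t, x), (⟨ht, hx⟩ : (t, x) ∈ Icc 0 S ×ˢ Icc 0 L)⟩ hc.continuousOn
  have hmin' : ∀ t ∈ Icc 0 S, ∀ x ∈ Icc 0 L, w s y ≤ w t x := fun t ht x hx =>
    hmin (show (t, x) ∈ Icc 0 S ×ˢ Icc 0 L from ⟨ht, hx⟩)
  by_contra! hneg
  have hsy : w s y < 0 := (hmin' t ht x hx).trans_lt hneg
  have hs0 : 0 < s := by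
    refine hs.1.lt_of_ne fun h => ?_
    subst h
    exact hsy.not_ge (hinit y hy)
  have hy0 : 0 < y := by
    refine hy.1.lt_of_ne fun h => ?_
    subst h
    exact hsy.not_ge (hleft s hs)
  rcases hy.2.eq_or_lt with rfl | hyL
  · refine (hright s ⟨hs0, hs.2⟩ hsy).not_ge ((hasDerivAt_pdx hw s y).nonpos_of_le_left hy0 ?_)
    exact fun z hz => hmin' s hs z ⟨hz.1.le, hz.2.le⟩
  · have hloc : IsLocalMin (w s) y := by
      filter_upwards [Ioo_mem_nhds hy0 hyL] with z hz
      exact hmin' s hs z ⟨hz.1.le, hz.2.le⟩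
    refine (hint s ⟨hs0, hs.2⟩ y ⟨hy0, hyL⟩ hsy hloc.deriv_eq_zero
      (hloc.deriv_deriv_nonneg (hasDerivAt_pdx hw s y).continuousAt)).not_ge
      ((hasDerivAt_pdt hw s y).nonpos_of_le_left hs0 ?_)
    exact fun z hz => hmin' z ⟨hz.1.le, hz.2.le.trans hs.2⟩ y hy

/-- Minimum principle for linear parabolic inequalities with bounded coefficients, with a Dirichlet
condition at `0` and a Robin condition at `L`. -/
lemma nonneg_of_parabolic {z : ℝ → ℝ → ℝ} {b c : ℝ → ℝ → ℝ} {T L a B κ : ℝ} (hT : 0 < T)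
    (ha : 0 ≤ a) (hz : ContDiff ℝ (⊤ : ℕ∞) (uncurry z))
    (hb : ∀ t ∈ Ioo 0 T, ∀ x ∈ Ioo 0 L, |b t x| ≤ B)
    (hc : ∀ t ∈ Ioo 0 T, ∀ x ∈ Ioo 0 L, |c t x| ≤ B)
    (hinit : ∀ x ∈ Icc 0 L, 0 ≤ z 0 x) (hleft : ∀ t ∈ Icc 0 T, 0 ≤ z t 0)
    (hright : ∀ t ∈ Ioo 0 T, z t L < 0 → κ * z t L < pdx z t L)
    (hint : ∀ t ∈ Ioo 0 T, ∀ x ∈ Ioo 0 L,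
      a * pdxx z t x + b t x * pdx z t x + c t x * z t x ≤ pdt z t x) :
    ∀ t ∈ Icc 0 T, ∀ x ∈ Icc 0 L, 0 ≤ z t x := by
  set ν : ℝ := a * κ ^ 2 + B * |κ| + B + 1 with hν
  set w : ℝ → ℝ → ℝ := fun t x => Real.exp (-ν * t - κ * x) * z t x with hwdef
  have hw : ContDiff ℝ (⊤ : ℕ∞) (uncurry w) := by
    have : uncurry w = fun p : ℝ × ℝ => Real.exp (-ν * p.1 - κ * p.2) * uncurry z p := rfl
    rw [this]
    fun_prop
  have hexp : ∀ t x, HasDerivAt (fun y => Real.exp (-ν * t - κ * y))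
      (Real.exp (-ν * t - κ * x) * (-κ)) x := fun t x => by
    have := (((hasDerivAt_id x).const_mul κ).const_sub (-ν * t)).exp
    simpa using this
  have hwx : ∀ t x, pdx w t x = Real.exp (-ν * t - κ * x) * (pdx z t x - κ * z t x) :=
    fun t x => by
    refine ((hexp t x).mul (hasDerivAt_pdx hz t x)).deriv.trans ?_
    ring
  have hwxx : ∀ t x, pdxx w t x =
      Real.exp (-ν * t - κ * x) * (pdxx z t x - 2 * κ * pdx z t x + κ ^ 2 * z t x) :=
    fun t x => by
    have h1 : deriv (w t) = fun x => Real.exp (-ν * t - κ * x) * (pdx z t x - κ * z t x) :=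
      funext (hwx t)
    change deriv (deriv (w t)) x = _
    rw [h1]
    refine ((hexp t x).mul ((hasDerivAt_pdxx hz t x).sub
      ((hasDerivAt_pdx hz t x).const_mul κ))).deriv.trans ?_
    simp only [Pi.sub_apply]
    ring
  have hwt : ∀ t x, pdt w t x = Real.exp (-ν * t - κ * x) * (pdt z t x - ν * z t x) :=
    fun t x => by
    have h1 : HasDerivAt (fun s => Real.exp (-ν * s - κ * x))
        (Real.exp (-ν * t - κ * x) * (-ν)) t := by
      have := (((hasDerivAt_id t).const_mul (-ν)).sub_const (κ * x)).exp
      simpa using this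
    refine (h1.mul (hasDerivAt_pdt hz t x)).deriv.trans ?_
    ring
  have hsign : ∀ t x, w t x < 0 ↔ z t x < 0 := fun t x => by
    simp only [hwdef]
    constructor
    · intro h
      by_contra! h'
      exact h.not_ge (mul_nonneg (Real.exp_pos _).le h')
    · exact fun h => mul_neg_of_pos_of_neg (Real.exp_pos _) h
  have main : ∀ t ∈ Ico 0 T, ∀ x ∈ Icc 0 L, 0 ≤ z t x := by
    intro t ht x hx
    have hsub : ∀ s ∈ Ioc 0 t, s ∈ Ioo 0 T := fun s hs => ⟨hs.1, hs.2.trans_lt ht.2⟩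
    have hwnn := nonneg_of_no_negative_min (S := t) (L := L) hw
      (fun x hx => mul_nonneg (Real.exp_pos _).le (hinit x hx))
      (fun s hs => mul_nonneg (Real.exp_pos _).le (hleft s ⟨hs.1, hs.2.trans ht.2.le⟩))
      (fun s hs hneg => by
        rw [hwx]
        exact mul_pos (Real.exp_pos _)
          (sub_pos.2 (hright s (hsub s hs) ((hsign s L).1 hneg))))
      (fun s hs y hy hneg hx0 hxx0 => by
        have hzn := (hsign s y).1 hneg
        have hE := Real.exp_pos (-ν * s - κ * y)
        rw [hwx] at hx0
        rw [hwxx] at hxx0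
        rw [hwt]
        have e1 : pdx z s y = κ * z s y := by
          have := (mul_eq_zero.1 hx0).resolve_left hE.ne'
          linarith
        have e2 := nonneg_of_mul_nonneg_right hxx0 hE
        rw [e1] at e2
        have e3 := hint s (hsub s hs) y hy
        rw [e1] at e3
        have hb' := hb s (hsub s hs) y hy
        have hc' := (abs_le.1 (hc s (hsub s hs) y hy)).2
        have hbk : b s y * κ ≤ B * |κ| :=
          (le_abs_self _).trans (by rw [abs_mul]; gcongr)
        refine mul_pos hE ?_
        have e4 : a * (κ ^ 2 * z s y) ≤ a * pdxx z s y :=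
          mul_le_mul_of_nonneg_left (by linarith) ha
        have e5 : (B * |κ| - b s y * κ + (B - c s y) + 1) * (-z s y) > 0 :=
          mul_pos (by linarith) (by linarith)
        rw [hν]
        nlinarith)
    by_contra! hneg
    exact ((hsign t x).2 hneg).not_ge (hwnn t ⟨ht.1, le_rfl⟩ x hx)
  intro t ht x hx
  have hcl : IsClosed {s | 0 ≤ z s x} :=
    isClosed_le continuous_const (hz.continuous.uncurry_right x)
  have hsub := hcl.closure_subset_iff.2 (fun s hs => main s hs x hx : Ico 0 T ⊆ _)
  rw [closure_Ico hT.ne] at hsub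
  exact hsub ht

end MaximumPrinciple

section MeanFieldGame

variable {T L σ r ε : ℝ} {uT m0 : ℝ → ℝ} {u m : ℝ → ℝ → ℝ}

lemma hasDerivAt_mfgG (hu : ContDiff ℝ (⊤ : ℕ∞) (uncurry u)) (t x : ℝ) :
    HasDerivAt (mfgG L ε u m t) (-(1 / 2) * pdxx u t x) x := by
  refine (((hasDerivAt_pdxx hu t x).const_sub (mfgF L ε u m t)).const_mul (1 / 2)).congr_deriv ?_
  ring

lemma IsMFGSolution.fp_expanded (h : IsMFGSolution T L σ r ε uT m0 u m) {t x : ℝ}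
    (ht : t ∈ Ioo 0 T) (hx : x ∈ Ioo 0 L) :
    pdt m t x = σ ^ 2 / 2 * pdxx m t x + mfgG L ε u m t x * pdx m t x
      + -(1 / 2) * pdxx u t x * m t x := by
  have h1 := h.fp t ht x hx
  have h2 := ((hasDerivAt_mfgG (L := L) (ε := ε) (m := m) h.u_smooth t x).mul (hasDerivAt_pdx h.m_smooth t x)).deriv
  change deriv (fun y => mfgG L ε u m t y * m t y) x = _ at h2
  rw [h2] at h1
  linarith

/-- The Hamilton-Jacobi-Bellman equation bounds `G` in terms of the derivatives of `u`. -/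
lemma IsMFGSolution.exists_bound_mfgG (hL : 0 < L) (h : IsMFGSolution T L σ r ε uT m0 u m) :
    ∃ B, ∀ t ∈ Ioo 0 T, ∀ x ∈ Icc 0 L, |mfgG L ε u m t x| ≤ B := by
  have hK : IsCompact (Icc 0 T ×ˢ Icc 0 L) := isCompact_Icc.prod isCompact_Icc
  have hc := h.u_smooth.continuous
  have hcx := (contDiff_uncurry_pdx h.u_smooth).continuous
  have hcxx := (contDiff_uncurry_pdxx h.u_smooth).continuous
  have hct := (contDiff_uncurry_pdt h.u_smooth).continuous
  obtain ⟨A, hA⟩ := hK.exists_bound_of_continuousOn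
    (f := fun p => uncurry (pdt u) p + σ ^ 2 / 2 * uncurry (pdxx u) p - r * uncurry u p)
    (by fun_prop)
  obtain ⟨D, hD⟩ := hK.exists_bound_of_continuousOn hcx.continuousOn
  have hhalf : L / 2 ∈ Ioo 0 L := ⟨by linarith, by linarith⟩
  refine ⟨A + 1 + D, fun t ht x hx => ?_⟩
  have ht' := Ioo_subset_Icc_self ht
  have h1 := (abs_le.1 (hA (t, L / 2) ⟨ht', Ioo_subset_Icc_self hhalf⟩)).1
  have h2 := abs_le.1 (hD (t, L / 2) ⟨ht', Ioo_subset_Icc_self hhalf⟩)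
  have h3 := abs_le.1 (hD (t, x) ⟨ht', hx⟩)
  have h4 := h.hjb t ht _ hhalf
  simp only [uncurry_apply_pair] at h1 h2 h3
  have h5 : mfgG L ε u m t (L / 2) ^ 2 ≤ A := by
    have : mfgH L ε u m t (L / 2) = mfgG L ε u m t (L / 2) ^ 2 := rfl
    linarith
  have h6 : |mfgG L ε u m t (L / 2)| ≤ A + 1 := by
    rw [abs_le]
    constructor <;> nlinarith [sq_nonneg (mfgG L ε u m t (L / 2) - 1),
      sq_nonneg (mfgG L ε u m t (L / 2) + 1)]
  have h7 : mfgG L ε u m t x =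
      mfgG L ε u m t (L / 2) + (1 / 2) * (pdx u t (L / 2) - pdx u t x) := by
    unfold mfgG
    ring
  rw [h7]
  refine (abs_add_le _ _).trans (add_le_add h6 ?_)
  rw [abs_le]
  constructor <;> linarith [h2.1, h2.2, h3.1, h3.2]

lemma IsMFGSolution.m_nonneg (hd : MFGData T L σ r ε uT m0)
    (h : IsMFGSolution T L σ r ε uT m0 u m) :
    ∀ t ∈ Icc 0 T, ∀ x ∈ Icc 0 L, 0 ≤ m t x := by
  obtain ⟨B, hB⟩ := h.exists_bound_mfgG hd.hL
  have hcxx := (contDiff_uncurry_pdxx h.u_smooth).continuous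
  obtain ⟨D, hD⟩ := (isCompact_Icc.prod isCompact_Icc :
    IsCompact (Icc 0 T ×ˢ Icc 0 L)).exists_bound_of_continuousOn
    (f := fun p => -(1 / 2) * uncurry (pdxx u) p) (by fun_prop)
  have hσ := hd.hσ
  have ha : 0 < σ ^ 2 / 2 := by positivity
  refine nonneg_of_parabolic (a := σ ^ 2 / 2) (B := max B D)
    (κ := (B + 1) / (σ ^ 2 / 2)) (b := mfgG L ε u m)
    (c := fun t x => -(1 / 2) * pdxx u t x) hd.hT ha.le h.m_smooth
    (fun t ht x hx => (hB t ht x (Ioo_subset_Icc_self hx)).trans (le_max_left _ _))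
    (fun t ht x hx => (hD (t, x) ⟨Ioo_subset_Icc_self ht, Ioo_subset_Icc_self hx⟩).trans
      (le_max_right _ _))
    (fun x hx => (h.m_init x hx).symm ▸ hd.m0_nonneg x hx)
    (fun t ht => (h.m_bdry t ht).ge) (fun t ht hneg => ?_)
    (fun t ht x hx => (h.fp_expanded ht hx).ge)
  have h1 := h.m_flux t (Ioo_subset_Icc_self ht)
  have h2 := (abs_le.1 (hB t ht L (right_mem_Icc.2 hd.hL.le))).1
  rw [div_mul_eq_mul_div, div_lt_iff₀ ha]
  have h3 : 0 < (B + 1 + mfgG L ε u m t L) * -m t L := mul_pos (by linarith) (by linarith)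
  linarith

lemma IsMFGSolution.u_nonneg (hd : MFGData T L σ r ε uT m0)
    (h : IsMFGSolution T L σ r ε uT m0 u m) :
    ∀ t ∈ Icc 0 T, ∀ x ∈ Icc 0 L, 0 ≤ u t x := by
  have hr := hd.hr
  set z : ℝ → ℝ → ℝ := fun t x => u (T - t) x with hzdef
  have hz : ContDiff ℝ (⊤ : ℕ∞) (uncurry z) := by
    have : uncurry z = fun p : ℝ × ℝ => uncurry u (T - p.1, p.2) := rfl
    rw [this]
    exact h.u_smooth.comp (by fun_prop)
  have hzt : ∀ t x, pdt z t x = -pdt u (T - t) x := fun t x => by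
    have := (hasDerivAt_pdt h.u_smooth (T - t) x).comp t ((hasDerivAt_id t).const_sub T)
    exact this.deriv.trans (by ring)
  have hrev : ∀ t ∈ Ioo 0 T, T - t ∈ Ioo 0 T := fun t ht =>
    ⟨by linarith [ht.2], by linarith [ht.1]⟩
  have hrev' : ∀ t ∈ Icc 0 T, T - t ∈ Icc 0 T := fun t ht =>
    ⟨by linarith [ht.2], by linarith [ht.1]⟩
  have key := nonneg_of_parabolic (L := L) (a := σ ^ 2 / 2) (B := r) (κ := 1)
    (b := fun _ _ => 0) (c := fun _ _ => -r) hd.hT (by positivity) hz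
    (fun _ _ _ _ => by simpa using hr.le) (fun _ _ _ _ => by simp [abs_of_pos hr])
    (fun x hx => by
      simp only [hzdef, sub_zero]
      rw [h.u_term x hx]
      exact hd.uT_nonneg x hx)
    (fun t ht => (h.u_bdry _ (hrev' t ht)).ge)
    (fun t ht hneg => by
      have : pdx z t L = 0 := h.ux_bdry _ (hrev' t (Ioo_subset_Icc_self ht))
      rw [this]
      linarith)
    (fun t ht x hx => by
      have h1 := h.hjb _ (hrev t ht) x hx
      have h2 : 0 ≤ mfgH L ε u m (T - t) x := sq_nonneg _
      have h3 : pdxx z t x = pdxx u (T - t) x := rfl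
      have h4 : z t x = u (T - t) x := rfl
      rw [hzt, h3, h4]
      linarith)
  intro t ht x hx
  have := key (T - t) (hrev' t ht) x hx
  simpa [hzdef] using this

lemma IsMFGSolution.mfgEta_nonneg (hd : MFGData T L σ r ε uT m0)
    (h : IsMFGSolution T L σ r ε uT m0 u m) : ∀ t ∈ Icc 0 T, 0 ≤ mfgEta L m t :=
  fun t ht => intervalIntegral.integral_nonneg hd.hL.le (h.m_nonneg hd t ht)

lemma IsMFGSolution.mfgEta_le_one (hd : MFGData T L σ r ε uT m0)
    (h : IsMFGSolution T L σ r ε uT m0 u m) : ∀ t ∈ Icc 0 T, mfgEta L m t ≤ 1 := by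
  have hderiv := hasDerivAt_integral_pdt h.m_smooth 0 L
  have hL := hd.hL
  have hanti : AntitoneOn (mfgEta L m) (Icc 0 T) := by
    refine antitoneOn_of_deriv_nonpos (convex_Icc 0 T)
      (fun t _ => (hderiv t).continuousAt.continuousWithinAt)
      (fun t _ => (hderiv t).differentiableAt.differentiableWithinAt) fun t ht => ?_
    rw [interior_Icc] at ht
    have ht' := Ioo_subset_Icc_self ht
    have hF : ∀ x, HasDerivAt (fun x => σ ^ 2 / 2 * pdx m t x + mfgG L ε u m t x * m t x)
        (σ ^ 2 / 2 * pdxx m t x + (-(1 / 2) * pdxx u t x * m t x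
          + mfgG L ε u m t x * pdx m t x)) x := fun x =>
      ((hasDerivAt_pdxx h.m_smooth t x).const_mul _).add
        ((hasDerivAt_mfgG h.u_smooth t x).mul (hasDerivAt_pdx h.m_smooth t x))
    have hG : Continuous (mfgG L ε u m t) :=
      continuous_iff_continuousAt.2 fun x => (hasDerivAt_mfgG h.u_smooth t x).continuousAt
    have c1 := (contDiff_uncurry_pdxx h.m_smooth).continuous.uncurry_left t
    have c2 := (contDiff_uncurry_pdxx h.u_smooth).continuous.uncurry_left t
    have c3 := h.m_smooth.continuous.uncurry_left t
    have c4 := (contDiff_uncurry_pdx h.m_smooth).continuous.uncurry_left t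
    have hint : deriv (mfgEta L m) t = (σ ^ 2 / 2 * pdx m t L + mfgG L ε u m t L * m t L)
        - (σ ^ 2 / 2 * pdx m t 0 + mfgG L ε u m t 0 * m t 0) := by
      rw [← intervalIntegral.integral_eq_sub_of_hasDerivAt (fun x _ => hF x)
        (Continuous.intervalIntegrable (by fun_prop) _ _)]
      refine (hderiv t).deriv.trans (intervalIntegral.integral_congr_Ioo_of_le hL.le ?_)
      intro x hx
      rw [h.fp_expanded ht hx]
      ring
    have hm0 := h.m_bdry t ht'
    have hmx : 0 ≤ pdx m t 0 := by
      have hneg : HasDerivAt (fun y => m t (-y)) (-pdx m t 0) 0 := by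
        have h1 : HasDerivAt (m t) (pdx m t 0) (-0) := by
          simpa using hasDerivAt_pdx h.m_smooth t 0
        exact (h1.comp (0 : ℝ) (hasDerivAt_neg 0)).congr_deriv (by ring)
      have := hneg.nonpos_of_le_left (b := -L) (by linarith) fun y hy => by
        simp only [neg_zero, hm0]
        exact h.m_nonneg hd t ht' _ ⟨by linarith [hy.2], by linarith [hy.1]⟩
      linarith
    rw [hint, h.m_flux t ht', hm0]
    have : 0 ≤ σ ^ 2 / 2 * pdx m t 0 := mul_nonneg (by positivity) hmx
    linarith
  intro t ht
  refine (hanti (left_mem_Icc.2 hd.hT.le) ht ht.1).trans_eq ?_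
  rw [← hd.m0_mass]
  refine intervalIntegral.integral_congr fun x hx => ?_
  rw [uIcc_of_le hL.le] at hx
  exact h.m_init x hx

/-- The definition of `f` as a fixed-point relation `f = 1 - ε ∫ G m`. -/
lemma mfgF_eq_one_sub (hu : ContDiff ℝ (⊤ : ℕ∞) (uncurry u))
    (hm : ContDiff ℝ (⊤ : ℕ∞) (uncurry m)) {t : ℝ} (h0 : 2 + ε * mfgEta L m t ≠ 0) :
    mfgF L ε u m t = 1 - ε * ∫ x in (0 : ℝ)..L, mfgG L ε u m t x * m t x := by
  have c1 := (contDiff_uncurry_pdx hu).continuous.uncurry_left t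
  have c2 := hm.continuous.uncurry_left t
  have hQ : (∫ x in (0 : ℝ)..L, mfgG L ε u m t x * m t x) =
      (1 / 2) * (mfgF L ε u m t * mfgEta L m t - ∫ x in (0 : ℝ)..L, pdx u t x * m t x) := by
    unfold mfgEta
    rw [← intervalIntegral.integral_const_mul, ← intervalIntegral.integral_sub
      (Continuous.intervalIntegrable (by fun_prop) _ _)
      (Continuous.intervalIntegrable (by fun_prop) _ _), ← intervalIntegral.integral_const_mul]
    refine intervalIntegral.integral_congr fun x _ => ?_
    simp only [mfgG]
    ring
  have hf : mfgF L ε u m t * (2 + ε * mfgEta L m t) =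
      2 + ε * ∫ x in (0 : ℝ)..L, pdx u t x * m t x := by
    rw [mfgF]
    field_simp
  rw [hQ]
  linarith

lemma IsMFGSolution.integral_duality (hd : MFGData T L σ r ε uT m0)
    (h : IsMFGSolution T L σ r ε uT m0 u m) {t : ℝ} (ht : t ∈ Ioo 0 T) :
    (∫ x in (0 : ℝ)..L, pdt (fun t x => u t x * m t x) t x) - r * ∫ x in (0 : ℝ)..L, u t x * m t x
      = (∫ x in (0 : ℝ)..L, m t x * mfgG L ε u m t x ^ 2)
        - mfgF L ε u m t * ∫ x in (0 : ℝ)..L, mfgG L ε u m t x * m t x := by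
  have hL := hd.hL
  have ht' := Ioo_subset_Icc_self ht
  have hu := h.u_smooth
  have hm := h.m_smooth
  have hprod : ContDiff ℝ (⊤ : ℕ∞) (uncurry fun t x => u t x * m t x) := hu.mul hm
  have c1 := (contDiff_uncurry_pdxx hm).continuous.uncurry_left t
  have c2 := (contDiff_uncurry_pdxx hu).continuous.uncurry_left t
  have c3 := (contDiff_uncurry_pdx hm).continuous.uncurry_left t
  have c4 := (contDiff_uncurry_pdx hu).continuous.uncurry_left t
  have c5 := hm.continuous.uncurry_left t
  have c6 := hu.continuous.uncurry_left t
  have c7 := (contDiff_uncurry_pdt hprod).continuous.uncurry_left t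
  have hG : Continuous (mfgG L ε u m t) :=
    continuous_iff_continuousAt.2 fun x => (hasDerivAt_mfgG hu t x).continuousAt
  have hflux : ∀ x, HasDerivAt (fun x => σ ^ 2 / 2 * (u t x * pdx m t x - m t x * pdx u t x)
      + u t x * (mfgG L ε u m t x * m t x)) (σ ^ 2 / 2 * ((pdx u t x * pdx m t x
        + u t x * pdxx m t x) - (pdx m t x * pdx u t x + m t x * pdxx u t x))
      + (pdx u t x * (mfgG L ε u m t x * m t x) + u t x * (-(1 / 2) * pdxx u t x * m t x
        + mfgG L ε u m t x * pdx m t x))) x := fun x =>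
    ((((hasDerivAt_pdx hu t x).mul (hasDerivAt_pdxx hm t x)).sub
      ((hasDerivAt_pdx hm t x).mul (hasDerivAt_pdxx hu t x))).const_mul _).add
      ((hasDerivAt_pdx hu t x).mul
        ((hasDerivAt_mfgG hu t x).mul (hasDerivAt_pdx hm t x)))
  have hzero := intervalIntegral.integral_eq_sub_of_hasDerivAt (a := 0) (b := L)
    (fun x _ => hflux x) (Continuous.intervalIntegrable (by fun_prop) _ _)
  have hbdry : σ ^ 2 / 2 * (u t L * pdx m t L - m t L * pdx u t L)
      + u t L * (mfgG L ε u m t L * m t L) = 0 := by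
    have h1 := h.m_flux t ht'
    rw [h.ux_bdry t ht']
    linear_combination u t L * h1
  rw [hbdry, h.u_bdry t ht', h.m_bdry t ht'] at hzero
  rw [← intervalIntegral.integral_const_mul, ← intervalIntegral.integral_const_mul,
    ← intervalIntegral.integral_sub (c7.intervalIntegrable _ _)
      (Continuous.intervalIntegrable (by fun_prop) _ _),
    ← intervalIntegral.integral_sub (Continuous.intervalIntegrable (by fun_prop) _ _)
      (Continuous.intervalIntegrable (by fun_prop) _ _), ← sub_eq_zero,
    ← intervalIntegral.integral_sub
      ((c7.intervalIntegrable _ _).sub (Continuous.intervalIntegrable (by fun_prop) _ _))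
      (Continuous.intervalIntegrable (by fun_prop) _ _)]
  refine (intervalIntegral.integral_congr_Ioo_of_le hL.le fun x hx => ?_).trans
    (hzero.trans (by ring))
  have e1 : pdt (fun t x => u t x * m t x) t x = pdt u t x * m t x + u t x * pdt m t x :=
    ((hasDerivAt_pdt hu t x).mul (hasDerivAt_pdt hm t x)).deriv
  have e2 := h.hjb t ht x hx
  have e3 := h.fp_expanded ht hx
  have e4 : pdx u t x = mfgF L ε u m t - 2 * mfgG L ε u m t x := by
    unfold mfgG
    ring
  simp only [mfgH] at e2
  simp only [e1]
  linear_combination m t x * e2 + u t x * e3 - mfgG L ε u m t x * m t x * e4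

/-- The duality identity controls the energy density at each time. -/
lemma IsMFGSolution.energy_le (hd : MFGData T L σ r ε uT m0)
    (h : IsMFGSolution T L σ r ε uT m0 u m) {t : ℝ} (ht : t ∈ Ioo 0 T) :
    (1 / 2) * (∫ x in (0 : ℝ)..L, m t x * mfgG L ε u m t x ^ 2) - 1 / 2 ≤
      (∫ x in (0 : ℝ)..L, pdt (fun t x => u t x * m t x) t x)
        - r * ∫ x in (0 : ℝ)..L, u t x * m t x := by
  have ht' := Ioo_subset_Icc_self ht
  have hη := h.mfgEta_nonneg hd t ht'
  have hη1 := h.mfgEta_le_one hd t ht'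
  have hε := hd.hε
  have hf := mfgF_eq_one_sub (L := L) (ε := ε) h.u_smooth h.m_smooth (t := t) (by positivity)
  have hG : Continuous (mfgG L ε u m t) :=
    continuous_iff_continuousAt.2 fun x => (hasDerivAt_mfgG h.u_smooth t x).continuousAt
  have hmc := h.m_smooth.continuous.uncurry_left t
  rw [h.integral_duality hd ht, hf]
  set Q := ∫ x in (0 : ℝ)..L, mfgG L ε u m t x * m t x with hQ
  have hQle : Q ≤ (1 / 2) * (∫ x in (0 : ℝ)..L, m t x * mfgG L ε u m t x ^ 2)
      + (1 / 2) * mfgEta L m t := by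
    unfold mfgEta
    rw [hQ, ← intervalIntegral.integral_const_mul, ← intervalIntegral.integral_const_mul,
      ← intervalIntegral.integral_add (Continuous.intervalIntegrable (by fun_prop) _ _)
      (Continuous.intervalIntegrable (by fun_prop) _ _)]
    refine intervalIntegral.integral_mono_on hd.hL.le
      (Continuous.intervalIntegrable (by fun_prop) _ _)
      (Continuous.intervalIntegrable (by fun_prop) _ _) fun x hx => ?_
    nlinarith [mul_nonneg (h.m_nonneg hd t ht' x hx) (sq_nonneg (mfgG L ε u m t x - 1))]
  nlinarith [mul_nonneg hε (sq_nonneg Q)]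

/-- Integrated energy estimate, with `K` a bound for the terminal data. -/
lemma IsMFGSolution.integral_energy_le (hd : MFGData T L σ r ε uT m0)
    (h : IsMFGSolution T L σ r ε uT m0 u m) {K : ℝ} (hK : ∀ x ∈ Icc 0 L, uT x ≤ K)
    (hK0 : 0 ≤ K) :
    (∫ t in (0 : ℝ)..T, ∫ x in (0 : ℝ)..L, m t x * mfgG L ε u m t x ^ 2)
      ≤ 2 * Real.exp (r * T) * (T / 2 + K) := by
  have hT := hd.hT
  have hL := hd.hL
  set Φ : ℝ → ℝ := fun t => ∫ x in (0 : ℝ)..L, m t x * mfgG L ε u m t x ^ 2 with hΦ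
  by_cases hint : IntervalIntegrable Φ volume 0 T
  swap
  · rw [intervalIntegral.integral_undef hint]
    positivity
  have hprod : ContDiff ℝ (⊤ : ℕ∞) (uncurry fun t x => u t x * m t x) :=
    h.u_smooth.mul h.m_smooth
  set P : ℝ → ℝ := fun t => ∫ x in (0 : ℝ)..L, u t x * m t x with hP
  set P' : ℝ → ℝ := fun t => ∫ x in (0 : ℝ)..L, pdt (fun t x => u t x * m t x) t x with hP'
  have hPd : ∀ t, HasDerivAt P (P' t) t := hasDerivAt_integral_pdt hprod 0 L
  have hPc : Continuous P := continuous_iff_continuousAt.2 fun t => (hPd t).continuousAt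
  have hPc' : Continuous P' := continuous_iff_continuousAt.2 fun t =>
    (hasDerivAt_integral_pdt (contDiff_uncurry_pdt hprod) 0 L t).continuousAt
  have hE : ∀ t, HasDerivAt (fun t => Real.exp (-r * t) * P t)
      (Real.exp (-r * t) * (P' t - r * P t)) t := fun t => by
    have h1 : HasDerivAt (fun s => Real.exp (-r * s)) (Real.exp (-r * t) * (-r)) t := by
      simpa using ((hasDerivAt_id t).const_mul (-r)).exp
    refine (h1.mul (hPd t)).congr_deriv ?_
    ring
  have hFTC := intervalIntegral.integral_eq_sub_of_hasDerivAt (a := 0) (b := T)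
    (fun t _ => hE t) (Continuous.intervalIntegrable (by fun_prop) _ _)
  have hmono : (∫ t in (0 : ℝ)..T, (Real.exp (-r * T) / 2 * Φ t - 1 / 2)) ≤
      ∫ t in (0 : ℝ)..T, Real.exp (-r * t) * (P' t - r * P t) := by
    refine intervalIntegral.integral_mono_on_of_le_Ioo hT.le
      ((hint.const_mul _).sub intervalIntegrable_const)
      (Continuous.intervalIntegrable (by fun_prop) _ _) fun t ht => ?_
    have h1 := h.energy_le hd ht
    have h2 : 0 ≤ Φ t := intervalIntegral.integral_nonneg hL.le fun x hx =>
      mul_nonneg (h.m_nonneg hd t (Ioo_subset_Icc_self ht) x hx) (sq_nonneg _)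
    have h3 : Real.exp (-r * t) ≤ 1 := Real.exp_le_one_iff.2 (by nlinarith [hd.hr, ht.1])
    have h4 : Real.exp (-r * T) ≤ Real.exp (-r * t) :=
      Real.exp_le_exp.2 (by nlinarith [hd.hr, ht.2])
    have h5 : Real.exp (-r * t) * ((1 / 2) * Φ t - 1 / 2) ≤
        Real.exp (-r * t) * (P' t - r * P t) :=
      mul_le_mul_of_nonneg_left h1 (Real.exp_pos _).le
    have h6 := mul_le_mul_of_nonneg_right h4 h2
    linarith
  rw [intervalIntegral.integral_sub (hint.const_mul _) intervalIntegrable_const,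
    intervalIntegral.integral_const_mul, intervalIntegral.integral_const, hFTC] at hmono
  have hP0 : 0 ≤ P 0 := intervalIntegral.integral_nonneg hL.le fun x hx =>
    mul_nonneg (h.u_nonneg hd 0 (left_mem_Icc.2 hT.le) x hx)
      (h.m_nonneg hd 0 (left_mem_Icc.2 hT.le) x hx)
  have hTm : T ∈ Icc 0 T := right_mem_Icc.2 hT.le
  have c1 := h.m_smooth.continuous.uncurry_left T
  have c2 := h.u_smooth.continuous.uncurry_left T
  have hPT : P T ≤ K := by
    have h1 : P T ≤ ∫ x in (0 : ℝ)..L, K * m T x := by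
      refine intervalIntegral.integral_mono_on hL.le
        (Continuous.intervalIntegrable (by fun_prop) _ _)
        (Continuous.intervalIntegrable (by fun_prop) _ _) fun x hx => ?_
      rw [h.u_term x hx]
      exact mul_le_mul_of_nonneg_right (hK x hx) (h.m_nonneg hd T hTm x hx)
    rw [intervalIntegral.integral_const_mul] at h1
    have h2 := mul_le_mul_of_nonneg_left (h.mfgEta_le_one hd T hTm) hK0
    unfold mfgEta at h2
    linarith
  have hexp : Real.exp (-r * T) ≤ 1 := Real.exp_le_one_iff.2 (by nlinarith [hd.hr])
  have hPT' : Real.exp (-r * T) * P T ≤ K := by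
    nlinarith [mul_le_mul_of_nonneg_left hPT (Real.exp_pos (-r * T)).le]
  have hinv : Real.exp (r * T) * Real.exp (-r * T) = 1 := by
    rw [← Real.exp_add]
    simp
  simp only [mul_zero, Real.exp_zero, one_mul, sub_zero, smul_eq_mul] at hmono
  have hfin : Real.exp (-r * T) / 2 * (∫ t in (0 : ℝ)..T, Φ t) ≤ T / 2 + K := by linarith
  have := mul_le_mul_of_nonneg_left hfin (by positivity : 0 ≤ 2 * Real.exp (r * T))
  refine le_trans (le_of_eq ?_) this
  linear_combination -(∫ t in (0 : ℝ)..T, Φ t) * hinv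

end MeanFieldGame

/-- a priori bound on ∫₀^T ∫₀^L m G² = ∫₀^T ∫₀^L m H, with a constant
depending only on the data. -/
theorem mfg_mG_sq_estimate (T L σ r ε : ℝ) (uT m0 : ℝ → ℝ)
    (hdata : MFGData T L σ r ε uT m0) :
    ∃ C : ℝ, 0 < C ∧ ∀ u m : ℝ → ℝ → ℝ, IsMFGSolution T L σ r ε uT m0 u m →
      (∫ t in (0:ℝ)..T, ∫ x in (0:ℝ)..L, m t x * (mfgG L ε u m t x)^2)
        = (∫ t in (0:ℝ)..T, ∫ x in (0:ℝ)..L, m t x * mfgH L ε u m t x) ∧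
      (∫ t in (0:ℝ)..T, ∫ x in (0:ℝ)..L, m t x * mfgH L ε u m t x) ≤ C := by
  obtain ⟨K, hK⟩ := (isCompact_Icc (a := (0 : ℝ)) (b := L)).exists_bound_of_continuousOn
    hdata.uT_smooth.continuous.continuousOn
  have hT := hdata.hT
  have hK0 : 0 ≤ K :=
    (norm_nonneg _).trans (hK 0 (left_mem_Icc.2 hdata.hL.le))
  refine ⟨2 * Real.exp (r * T) * (T / 2 + K), by positivity, fun u m h => ⟨rfl, ?_⟩⟩
  exact h.integral_energy_le hdata (fun x hx => (le_abs_self _).trans (hK x hx)) hK0
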